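/- arXiv:1502.04377 — 2 statements merged into one kernel-verified Lean document; each statement's English description precedes it below -/
import Mathlib

section
/- (Duchon's meta-theorem.) Let S be a finite set of integers and let a_S(n) be the number of sequences w : Fin n → ℤ with every entry in S, all partial sums nonnegative, and total sum 0. Then the generating function f_S(t) = Σ_{n≥0} a_S(n)·tⁿ ∈ ℚ[[t]] is algebraic over the polynomial ring ℚ[t]: there exists a nonzero polynomial P with coefficients in ℚ[t] such that P(f_S) = 0 in ℚ[[t]]. -/
/-- The number of sequences `w : Fin n → ℤ` with every entry in `S`,
all partial sums `Σ_{j<i} w j` (for `i ≤ n`) nonnegative, and total sum `0`. -/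
noncomputable def aS (S : Finset ℤ) (n : ℕ) : ℕ :=
  Nat.card {w : Fin n → ℤ //
    (∀ i, w i ∈ S) ∧
    (∀ i : ℕ, i ≤ n → 0 ≤ ∑ j ∈ Finset.univ.filter (fun j : Fin n => (j : ℕ) < i), w j) ∧
    (∑ j, w j) = 0}



/-- Number of walks of length `n` from `i` to `c` staying nonnegative. -/
noncomputable def cntW (S : Finset ℤ) (c : ℤ) : ℕ → ℤ → ℚ
  | 0, i => if i = c then 1 else 0
  | n + 1, i => if 0 ≤ i then ∑ s ∈ S, cntW S c n (i + s) else 0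

noncomputable def hW (S : Finset ℤ) (i c : ℤ) : PowerSeries ℚ :=
  PowerSeries.mk fun n => cntW S c n i

lemma hW_neg (S : Finset ℤ) {i c : ℤ} (hi : i < 0) (hc : 0 ≤ c) : hW S i c = 0 := by
  ext n
  cases n with
  | zero => simp only [hW, PowerSeries.coeff_mk, cntW, map_zero]; rw [if_neg (by omega)]
  | succ n => simp only [hW, PowerSeries.coeff_mk, cntW, map_zero]; rw [if_neg (by omega)]

lemma hW_nonneg (S : Finset ℤ) {i : ℤ} (c : ℤ) (hi : 0 ≤ i) :
    hW S i c = (if i = c then 1 else 0) + PowerSeries.X * ∑ s ∈ S, hW S (i + s) c := by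
  ext n
  cases n with
  | zero =>
    simp only [hW, PowerSeries.coeff_mk, cntW, map_add, PowerSeries.coeff_zero_X_mul]
    split_ifs <;> simp
  | succ n =>
    simp only [hW, PowerSeries.coeff_mk, cntW, map_add, PowerSeries.coeff_succ_X_mul, map_sum,
      if_pos hi]
    split_ifs <;> simp [PowerSeries.coeff_one]

lemma uniqW (S : Finset ℤ) (g : ℤ → PowerSeries ℚ) (h0 : ∀ i < 0, g i = 0)
    (h1 : ∀ i, 0 ≤ i → g i = PowerSeries.X * ∑ s ∈ S, g (i + s)) (i : ℤ) : g i = 0 := by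
  ext n
  induction n generalizing i with
  | zero =>
    rcases lt_or_ge i 0 with h | h
    · rw [h0 i h]
    · rw [h1 i h]; simp
  | succ n ih =>
    rcases lt_or_ge i 0 with h | h
    · rw [h0 i h]
    · rw [h1 i h, PowerSeries.coeff_succ_X_mul, map_sum]
      simp [ih]

noncomputable def bW (S : Finset ℤ) (d c r : ℤ) : PowerSeries ℚ :=
  PowerSeries.X * ∑ s ∈ S, if r + s < 0 then hW S (r + s + d) c else 0

lemma shiftW (S : Finset ℤ) (d : ℤ) (hd : ∀ s ∈ S, |s| ≤ d) (c : ℤ)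
    (hc : 0 ≤ c) (hcd : c < d) (i : ℤ) (hi : 0 ≤ i) :
    hW S (i + d) c = ∑ r ∈ Finset.Ico 0 d, hW S i r * bW S d c r := by
  have key := uniqW S (fun i => if i < 0 then 0 else
    hW S (i + d) c - ∑ r ∈ Finset.Ico 0 d, hW S i r * bW S d c r)
    (fun i hi => by simp [hi]) (fun i hi => by
      have e1 : hW S (i + d) c = PowerSeries.X * ∑ s ∈ S, hW S (i + s + d) c := by
        rw [hW_nonneg S c (by omega), if_neg (by omega), zero_add]
        simp only [add_right_comm]
      have e2 : ∑ r ∈ Finset.Ico 0 d, hW S i r * bW S d c r = bW S d c i +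
          PowerSeries.X * ∑ s ∈ S, ∑ r ∈ Finset.Ico 0 d, hW S (i + s) r * bW S d c r := by
        have : ∀ r ∈ Finset.Ico 0 d, hW S i r * bW S d c r = (if i = r then bW S d c r else 0) +
            ∑ s ∈ S, PowerSeries.X * (hW S (i + s) r * bW S d c r) := by
          intro r _
          rw [hW_nonneg S r hi, add_mul, mul_assoc, Finset.sum_mul, Finset.mul_sum]
          split_ifs <;> simp
        rw [Finset.sum_congr rfl this, Finset.sum_add_distrib, Finset.sum_comm, Finset.mul_sum]
        simp only [Finset.mul_sum, Finset.sum_ite_eq, Finset.mem_Ico]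
        congr 1
        split_ifs with h
        · rfl
        · rw [bW, Finset.sum_eq_zero, mul_zero]
          intro s hs
          have := abs_le.1 (hd s hs)
          rw [if_neg (by omega)]
      simp only [if_neg (not_lt.2 hi)]
      rw [e1, e2, bW, ← sub_sub, ← mul_sub, ← mul_sub, ← Finset.sum_sub_distrib,
        ← Finset.sum_sub_distrib]
      congr 1
      refine Finset.sum_congr rfl fun s _ => ?_
      split_ifs with h
      · rw [sub_self, zero_sub, neg_eq_zero]
        refine Finset.sum_eq_zero fun r hr => ?_
        rw [hW_neg S h (Finset.mem_Ico.1 hr).1, zero_mul]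
      · simp) i
  simp only [if_neg (not_lt.2 hi)] at key
  exact sub_eq_zero.1 key

lemma card_eq_cntW (S : Finset ℤ) (n : ℕ) (i : ℤ) :
    (Nat.card {w : Fin n → ℤ //
    (∀ i, w i ∈ S) ∧
    (∀ k : ℕ, k ≤ n → 0 ≤ i + ∑ j ∈ Finset.univ.filter (fun j : Fin n => (j : ℕ) < k), w j) ∧
    i + (∑ j, w j) = 0} : ℚ) = cntW S 0 n i := by
  induction n generalizing i with
  | zero =>
    by_cases h : i = 0 <;> simp [cntW, h]
  | succ n ih =>
    by_cases hi : 0 ≤ i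
    · rw [cntW, if_pos hi, ← Finset.sum_coe_sort]
      simp only [← ih]
      rw [← Nat.cast_sum]
      have fin : ∀ i : ℤ, Finite {w : Fin n → ℤ //
        (∀ i, w i ∈ S) ∧
        (∀ k : ℕ, k ≤ n → 0 ≤ i + ∑ j ∈ Finset.univ.filter (fun j : Fin n => (j : ℕ) < k), w j) ∧
        i + (∑ j, w j) = 0} := fun i => by
          refine Finite.of_injective (β := Fin n → S) (fun w j => ⟨w.1 j, w.2.1 j⟩) ?_
          intro a b hab
          ext j
          exact congrArg Subtype.val (congrFun hab j)
      rw [← Nat.card_sigma]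
      congr 1
      have hs : ∀ (w : Fin (n + 1) → ℤ) (k : ℕ),
          ∑ j ∈ Finset.univ.filter (fun j : Fin (n + 1) => (j : ℕ) < k + 1), w j =
          w 0 + ∑ j ∈ Finset.univ.filter (fun j : Fin n => (j : ℕ) < k), w j.succ := by
        intro w k
        simp [Finset.sum_filter, Fin.sum_univ_succ]
      refine Nat.card_congr
        { toFun := fun w => ⟨⟨w.1 0, w.2.1 0⟩, ⟨Fin.tail w.1, fun j => w.2.1 _, fun k hk => ?_, ?_⟩⟩
          invFun := fun p => ⟨Fin.cons p.1.1 p.2.1, fun j => ?_, fun k hk => ?_, ?_⟩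
          left_inv := fun w => ?_
          right_inv := fun p => ?_ }
      · have := w.2.2.1 (k + 1) (by omega)
        rw [hs] at this
        simpa [Fin.tail, add_assoc] using this
      · have := w.2.2.2
        rw [Fin.sum_univ_succ] at this
        simpa [Fin.tail, add_assoc] using this
      · refine Fin.cases ?_ (fun j => ?_) j
        · exact p.1.2
        · exact p.2.2.1 j
      · cases k with
        | zero => simpa using hi
        | succ k =>
          have := p.2.2.2.1 k (by omega)
          rw [hs]
          simpa [add_assoc] using this
      · have := p.2.2.2.2
        rw [Fin.sum_univ_succ]
        simpa [add_assoc] using this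
      · ext j; simp
      · rcases p with ⟨⟨s, hs⟩, ⟨w, hw⟩⟩; rfl
    · rw [cntW, if_neg hi]
      norm_cast
      rw [Nat.card_eq_zero]
      left
      refine ⟨fun w => hi ?_⟩
      simpa using w.2.2.1 0 (by omega)

lemma aS_eq (S : Finset ℤ) : (PowerSeries.mk fun n => (aS S n : ℚ) : PowerSeries ℚ) = hW S 0 0 := by
  ext n
  simp only [hW, PowerSeries.coeff_mk, ← card_eq_cntW, zero_add, aS]

section Der

variable {K L : Type*} [Field K] [Field L] [Algebra K L] [Algebra (PowerSeries ℚ) L]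

/-- Power series lying in `F` whose image under the derivation lies in `V`. -/
def subW (F : IntermediateField K L) (δ : Derivation K F L)
    (V : Submodule (PowerSeries ℚ) L) : Subsemiring (PowerSeries ℚ) where
  carrier := {y | ∃ y' : F, (y' : L) = algebraMap (PowerSeries ℚ) L y ∧ δ y' ∈ V}
  zero_mem' := ⟨0, by simp, by simp⟩
  one_mem' := ⟨1, by simp, by simp⟩
  add_mem' := by
    rintro a b ⟨a', ha, ha'⟩ ⟨b', hb, hb'⟩
    exact ⟨a' + b', by simp [ha, hb], by rw [map_add]; exact V.add_mem ha' hb'⟩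
  mul_mem' := by
    rintro a b ⟨a', ha, ha'⟩ ⟨b', hb, hb'⟩
    refine ⟨a' * b', by simp [ha, hb], ?_⟩
    rw [Derivation.leibniz, IntermediateField.smul_def, IntermediateField.smul_def, ha, hb,
      smul_eq_mul, smul_eq_mul, ← Algebra.smul_def, ← Algebra.smul_def]
    exact V.add_mem (V.smul_mem _ hb') (V.smul_mem _ ha')

lemma derW (S : Finset ℤ) (d : ℤ) (hd : ∀ s ∈ S, |s| ≤ d)
    (X' : K) (hX : algebraMap K L X' = algebraMap (PowerSeries ℚ) L PowerSeries.X)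
    (F : IntermediateField K L)
    (hF : ∀ p : Finset.Ico (0 : ℤ) d × Finset.Ico (0 : ℤ) d,
      algebraMap (PowerSeries ℚ) L (hW S p.1 p.2) ∈ F) (δ : Derivation K F L)
    (p : Finset.Ico (0 : ℤ) d × Finset.Ico (0 : ℤ) d) : δ ⟨_, hF p⟩ = 0 := by
  set V : Submodule (PowerSeries ℚ) L := Submodule.span _ (Set.range fun p => δ ⟨_, hF p⟩) with hV
  have hVp : ∀ p, δ ⟨_, hF p⟩ ∈ V := fun p => Submodule.subset_span ⟨p, rfl⟩
  set B := subW F δ V with hB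
  have hXB : PowerSeries.X ∈ B := by
    refine ⟨algebraMap K F X', hX, by simp⟩
  have m0 : ∀ i c, i < d → 0 ≤ c → c < d → hW S i c ∈ B := by
    intro i c h1 h2 h3
    rcases lt_or_ge i 0 with h | h
    · rw [hW_neg S h h2]; exact zero_mem _
    · exact ⟨⟨_, hF (⟨i, Finset.mem_Ico.2 ⟨h, h1⟩⟩, ⟨c, Finset.mem_Ico.2 ⟨h2, h3⟩⟩)⟩, rfl, hVp _⟩
  have mb : ∀ r c, 0 ≤ c → c < d → bW S d c r ∈ B := by
    intro r c h2 h3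
    refine mul_mem hXB (sum_mem fun s _ => ?_)
    split_ifs with h
    · exact m0 _ _ (by omega) h2 h3
    · exact zero_mem _
  have m1 : ∀ i c, i < 2 * d → 0 ≤ c → c < d → hW S i c ∈ B := by
    intro i c h1 h2 h3
    rcases lt_or_ge i d with h | h
    · exact m0 i c h h2 h3
    · have := shiftW S d hd c h2 h3 (i - d) (by omega)
      rw [sub_add_cancel] at this
      rw [this]
      refine sum_mem fun r hr => ?_
      rw [Finset.mem_Ico] at hr
      exact mul_mem (m0 _ _ (by omega) hr.1 hr.2) (mb _ _ h2 h3)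
  have hVb : V = ⊥ := by
    refine Submodule.eq_bot_of_le_smul_of_le_jacobson_bot
      (Ideal.span {(PowerSeries.X : PowerSeries ℚ)}) V
      (Submodule.fg_span (Set.finite_range _)) ?_ ?_
    · conv_lhs => rw [hV]
      rw [Submodule.span_le]
      rintro _ ⟨⟨⟨i, hi⟩, ⟨c, hc⟩⟩, rfl⟩
      have hi' := Finset.mem_Ico.1 hi
      have hc' := Finset.mem_Ico.1 hc
      have hm : ∑ s ∈ S, hW S (i + s) c ∈ B := sum_mem fun s hs =>
        m1 _ _ (by have := abs_le.1 (hd s hs); omega) hc'.1 hc'.2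
      obtain ⟨y, hy, hy'⟩ := hm
      have e : (⟨_, hF (⟨i, hi⟩, ⟨c, hc⟩)⟩ : F) =
          algebraMap K F (if i = c then 1 else 0) + algebraMap K F X' * y := by
        apply Subtype.ext
        change algebraMap (PowerSeries ℚ) L (hW S i c) =
          algebraMap K L (if i = c then 1 else 0) + algebraMap K L X' * (y : L)
        rw [hW_nonneg S c hi'.1, hX, hy]
        split_ifs <;> simp
      change δ (⟨_, hF (⟨i, hi⟩, ⟨c, hc⟩)⟩ : F) ∈ _
      rw [e, map_add, Derivation.map_algebraMap, zero_add, Derivation.leibniz,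
        Derivation.map_algebraMap, smul_zero, add_zero, IntermediateField.smul_def]
      change algebraMap K L X' • δ y ∈ _
      rw [hX, smul_eq_mul, ← Algebra.smul_def]
      exact Submodule.smul_mem_smul (Ideal.mem_span_singleton_self _) hy'
    · rw [Ideal.span_singleton_le_iff_mem, Ideal.mem_jacobson_bot]
      intro y
      rw [PowerSeries.isUnit_iff_constantCoeff]
      simp
  have := hVp p
  rwa [hVb, Submodule.mem_bot] at this

lemma algW (S : Finset ℤ) (d : ℤ) (hd : ∀ s ∈ S, |s| ≤ d)
    (X' : K) (hX : algebraMap K L X' = algebraMap (PowerSeries ℚ) L PowerSeries.X)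
    (p : Finset.Ico (0 : ℤ) d × Finset.Ico (0 : ℤ) d) :
    IsAlgebraic K (algebraMap (PowerSeries ℚ) L (hW S p.1 p.2)) := by
  set G : Set L := Set.range fun p : Finset.Ico (0 : ℤ) d × Finset.Ico (0 : ℤ) d =>
    algebraMap (PowerSeries ℚ) L (hW S p.1 p.2) with hG
  set F := IntermediateField.adjoin K G with hFdef
  have hF : ∀ p : Finset.Ico (0 : ℤ) d × Finset.Ico (0 : ℤ) d,
      algebraMap (PowerSeries ℚ) L (hW S p.1 p.2) ∈ F :=
    fun p => IntermediateField.subset_adjoin _ _ ⟨p, rfl⟩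
  have hess : Algebra.EssFiniteType K F := by
    rw [IntermediateField.essFiniteType_iff]
    exact IntermediateField.fg_adjoin_of_finite (Set.finite_range _)
  have hunr : Algebra.FormallyUnramified K F := by
    have hD : ∀ δ : Derivation K F L, δ = 0 := by
      intro δ
      ext ⟨x, hx⟩
      induction hx using IntermediateField.adjoin_induction with
      | mem x hx =>
        obtain ⟨q, rfl⟩ := hx
        exact derW S d hd X' hX F hF δ q
      | algebraMap x => exact δ.map_algebraMap x
      | add x y hx hy h1 h2 =>
        have := δ.map_add ⟨x, hx⟩ ⟨y, hy⟩
        rw [h1, h2] at this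
        simpa using this
      | mul x y hx hy h1 h2 =>
        have := δ.leibniz ⟨x, hx⟩ ⟨y, hy⟩
        rw [h1, h2] at this
        simpa using this
      | inv x hx h1 =>
        have := δ.leibniz_inv ⟨x, hx⟩
        rw [h1, Derivation.zero_apply, smul_zero] at this
        exact this
    constructor
    have h0 : ∀ x, KaehlerDifferential.D K F x = 0 := by
      intro x
      rw [← Module.forall_dual_apply_eq_zero_iff F]
      intro φ
      have := congrArg (fun δ => δ x)
        (hD (((Algebra.linearMap F L).comp φ).compDer (KaehlerDifferential.D K F)))
      simpa using this
    have := KaehlerDifferential.span_range_derivation K F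
    rw [← Submodule.subsingleton_iff F, ← subsingleton_iff_bot_eq_top, ← this, eq_comm,
      Submodule.span_eq_bot]
    rintro _ ⟨x, rfl⟩
    exact h0 x
  have hsep := Algebra.FormallyUnramified.isSeparable K F
  have h := (Algebra.IsAlgebraic.isAlgebraic (R := K) (⟨_, hF p⟩ : F))
  exact h.algebraMap (A := L)

end Der

/-- Duchon's meta-theorem: the generating function of debt-free walks with
steps in a finite set `S` and total sum `0` is algebraic over `ℚ[t]`. -/
theorem stmt15 (S : Finset ℤ) :
    IsAlgebraic (Polynomial ℚ)
      (PowerSeries.mk fun n => (aS S n : ℚ) : PowerSeries ℚ) := by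
  rw [aS_eq]
  have hinj : Function.Injective (algebraMap (Polynomial ℚ) (PowerSeries ℚ)) :=
    Polynomial.coe_injective ℚ
  have hinj2 := IsFractionRing.injective (PowerSeries ℚ) (FractionRing (PowerSeries ℚ))
  have : FaithfulSMul (Polynomial ℚ) (PowerSeries ℚ) :=
    (faithfulSMul_iff_algebraMap_injective _ _).2 hinj
  have : FaithfulSMul (Polynomial ℚ) (FractionRing (PowerSeries ℚ)) := by
    rw [faithfulSMul_iff_algebraMap_injective,
      IsScalarTower.algebraMap_eq _ (PowerSeries ℚ) (FractionRing (PowerSeries ℚ))]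
    exact hinj2.comp hinj
  let _ := FractionRing.liftAlgebra (Polynomial ℚ) (FractionRing (PowerSeries ℚ))
  obtain ⟨d, hd0, hd⟩ : ∃ d : ℤ, 0 < d ∧ ∀ s ∈ S, |s| ≤ d :=
    ⟨1 + ∑ s ∈ S, |s|, by have := Finset.sum_nonneg (fun s (_ : s ∈ S) => abs_nonneg s); omega,
      fun s hs => by
        have := Finset.single_le_sum (fun s (_ : s ∈ S) => abs_nonneg s) hs
        omega⟩
  have h := algW (K := FractionRing (Polynomial ℚ)) (L := FractionRing (PowerSeries ℚ)) S d hd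
    (algebraMap (Polynomial ℚ) _ Polynomial.X) (by
      rw [← IsScalarTower.algebraMap_apply,
        IsScalarTower.algebraMap_apply _ (PowerSeries ℚ) (FractionRing (PowerSeries ℚ))]
      congr 1
      exact Polynomial.coe_X)
    (⟨0, Finset.mem_Ico.2 ⟨le_rfl, hd0⟩⟩, ⟨0, Finset.mem_Ico.2 ⟨le_rfl, hd0⟩⟩)
  rw [← IsFractionRing.isAlgebraic_iff (Polynomial ℚ),
    isAlgebraic_algebraMap_iff hinj2] at h
  exact h
end

section
/- Let a(n) be the number of sequences w : Fin n → ℤ with every entry in {-1, -2, 3}, all partial sums Σ_{j<i} w(j) nonnegative, and total sum 0. Then a is P-recursive of order at most 20: there exist polynomials q₀, q₁, …, q₂₀ ∈ ℚ[x], not all zero, such that for all n ∈ ℕ, Σ_{i=0}^{20} qᵢ(n)·a(n + i) = 0. -/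
/-- The number of sequences `w : Fin n → ℤ` with every entry in `{-1, -2, 3}`,
all partial sums `Σ_{j<i} w j` (for `i ≤ n`) nonnegative, and total sum `0`. -/
noncomputable def a (n : ℕ) : ℕ :=
  Nat.card {w : Fin n → ℤ //
    (∀ i, w i = -1 ∨ w i = -2 ∨ w i = 3) ∧
    (∀ i : ℕ, i ≤ n → 0 ≤ ∑ j ∈ Finset.univ.filter (fun j : Fin n => (j : ℕ) < i), w j) ∧
    (∑ j, w j) = 0}

/-- Walks of length `n` ending at height `h`. -/
def walkSet (n : ℕ) (h : ℤ) : Set (Fin n → ℤ) :=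
  {w | (∀ i, w i = -1 ∨ w i = -2 ∨ w i = 3) ∧
    (∀ i : ℕ, i ≤ n → 0 ≤ ∑ j ∈ Finset.univ.filter (fun j : Fin n => (j : ℕ) < i), w j) ∧
    (∑ j, w j) = h}

/-- The number of walks, computed recursively. -/
def walkCount : ℕ → ℤ → ℕ
  | 0, h => if h = 0 then 1 else 0
  | (n+1), h => if 0 ≤ h then
      walkCount n (h+1) + walkCount n (h+2) + walkCount n (h-3) else 0

theorem walkSet_neg (n : ℕ) (h : ℤ) (hh : h < 0) : walkSet n h = ∅ := by
  ext w
  simp only [walkSet, Set.mem_setOf_eq, Set.mem_empty_iff_false, iff_false]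
  rintro ⟨-, h2, h3⟩
  have := h2 n le_rfl
  simp only [Fin.is_lt, Finset.filter_true] at this
  omega

theorem walkSet_snoc (n : ℕ) (h c : ℤ) (hh : 0 ≤ h) (hc : c = -1 ∨ c = -2 ∨ c = 3)
    (w : Fin n → ℤ) :
    (Fin.snoc w c : Fin (n+1) → ℤ) ∈ walkSet (n+1) h ↔ w ∈ walkSet n (h - c) := by
  have key : ∀ i : ℕ, i ≤ n → ∑ j ∈ Finset.univ.filter (fun j : Fin (n+1) => (j : ℕ) < i),
      (Fin.snoc w c : Fin (n+1) → ℤ) j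
      = ∑ j ∈ Finset.univ.filter (fun j : Fin n => (j : ℕ) < i), w j := by
    intro i hi
    rw [Finset.sum_filter, Finset.sum_filter, Fin.sum_univ_castSucc]
    simp [hi]
  have tot : ∑ j, (Fin.snoc w c : Fin (n+1) → ℤ) j = ∑ j, w j + c := by
    rw [Fin.sum_univ_castSucc]; simp
  simp only [walkSet, Set.mem_setOf_eq]
  rw [tot]
  constructor
  · rintro ⟨h1, h2, h3⟩
    refine ⟨fun i => ?_, fun i hi => ?_, by linarith⟩
    · simpa using h1 i.castSucc
    · rw [← key i hi]; exact h2 i (by omega)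
  · rintro ⟨h1, h2, h3⟩
    refine ⟨fun i => ?_, fun i hi => ?_, by linarith⟩
    · refine Fin.lastCases ?_ (fun i => ?_) i
      · simpa using hc
      · simpa using h1 i
    · rcases Nat.lt_or_ge n i with hi' | hi'
      · have : i = n+1 := by omega
        subst this
        simp only [Fin.is_lt, Finset.filter_true]
        rw [tot]; linarith
      · rw [key i hi']; exact h2 i hi'

theorem walkSet_succ (n : ℕ) (h : ℤ) (hh : 0 ≤ h) :
    walkSet (n+1) h =
      ((fun w : Fin n → ℤ => (Fin.snoc w (-1) : Fin (n+1) → ℤ)) '' walkSet n (h+1) ∪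
       (fun w : Fin n → ℤ => (Fin.snoc w (-2) : Fin (n+1) → ℤ)) '' walkSet n (h+2)) ∪
       (fun w : Fin n → ℤ => (Fin.snoc w 3 : Fin (n+1) → ℤ)) '' walkSet n (h-3) := by
  ext w
  constructor
  · intro hw
    have hl := hw.1 (Fin.last n)
    have e : (Fin.snoc (Fin.init w) (w (Fin.last n)) : Fin (n+1) → ℤ) = w := Fin.snoc_init_self w
    rcases hl with hl | hl | hl
    · rw [hl] at e
      rw [← e, walkSet_snoc n h _ hh (by simp)] at hw
      exact Or.inl (Or.inl ⟨_, by simpa using hw, e⟩)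
    · rw [hl] at e
      rw [← e, walkSet_snoc n h _ hh (by simp)] at hw
      exact Or.inl (Or.inr ⟨_, by simpa using hw, e⟩)
    · rw [hl] at e
      rw [← e, walkSet_snoc n h _ hh (by simp)] at hw
      exact Or.inr ⟨_, by simpa using hw, e⟩
  · rintro ((⟨v, hv, rfl⟩ | ⟨v, hv, rfl⟩) | ⟨v, hv, rfl⟩)
    · exact (walkSet_snoc n h _ hh (by simp) v).2 (by simpa using hv)
    · exact (walkSet_snoc n h _ hh (by simp) v).2 (by simpa using hv)
    · exact (walkSet_snoc n h _ hh (by simp) v).2 (by simpa using hv)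

theorem snoc_inj (n : ℕ) (c : ℤ) :
    Function.Injective (fun w : Fin n → ℤ => (Fin.snoc w c : Fin (n+1) → ℤ)) := by
  intro v w h
  have := congrArg Fin.init h
  simpa using this

theorem walkSet_card (n : ℕ) : ∀ h : ℤ, (walkSet n h).Finite ∧
    (walkSet n h).ncard = walkCount n h := by
  induction n with
  | zero =>
    intro h
    refine ⟨Set.toFinite _, ?_⟩
    by_cases hh : h = 0
    · have : walkSet 0 h = Set.univ := by
        ext w; simp [walkSet, hh]
      rw [this]; simp [walkCount, hh]
    · have : walkSet 0 h = ∅ := by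
        ext w; simp [walkSet]; exact fun e => hh e.symm
      rw [this]; simp [walkCount, hh]
  | succ n ih =>
    intro h
    by_cases hh : 0 ≤ h
    · rw [walkSet_succ n h hh]
      have f1 := ((ih (h+1)).1).image (fun w : Fin n → ℤ => (Fin.snoc w (-1) : Fin (n+1) → ℤ))
      have f2 := ((ih (h+2)).1).image (fun w : Fin n → ℤ => (Fin.snoc w (-2) : Fin (n+1) → ℤ))
      have f3 := ((ih (h-3)).1).image (fun w : Fin n → ℤ => (Fin.snoc w 3 : Fin (n+1) → ℤ))
      refine ⟨(f1.union f2).union f3, ?_⟩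
      rw [Set.ncard_union_eq ?_ (f1.union f2) f3, Set.ncard_union_eq ?_ f1 f2,
        Set.ncard_image_of_injective _ (snoc_inj n _),
        Set.ncard_image_of_injective _ (snoc_inj n _),
        Set.ncard_image_of_injective _ (snoc_inj n _), (ih _).2, (ih _).2, (ih _).2]
      · simp [walkCount, hh]
      · rw [Set.disjoint_left]
        rintro _ ⟨v, -, rfl⟩ ⟨u, -, hu⟩
        have := congrFun hu (Fin.last n)
        simp at this
      · rw [Set.disjoint_left]
        rintro _ (⟨v, -, rfl⟩ | ⟨v, -, rfl⟩) ⟨u, -, hu⟩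
        · have := congrFun hu (Fin.last n)
          simp at this
        · have := congrFun hu (Fin.last n)
          simp at this
    · rw [walkSet_neg _ _ (by omega)]
      simp [walkCount, hh]

theorem a_eq_walkCount (n : ℕ) : a n = walkCount n 0 := by
  rw [← (walkSet_card n 0).2, ← Nat.card_coe_set_eq]
  rfl

theorem walkCount_neg (n : ℕ) (h : ℤ) (hh : h < 0) : walkCount n h = 0 := by
  rw [← (walkSet_card n h).2, walkSet_neg n h hh]; simp

open PowerSeries in
/-- generating function of walks ending at height `h` -/
noncomputable def Fh (h : ℕ) : PowerSeries ℚ := PowerSeries.mk fun n => (walkCount n h : ℚ)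

open PowerSeries in
theorem Fh_rec (h : ℕ) : Fh h = (if h = 0 then 1 else 0) +
    X * (Fh (h+1) + Fh (h+2) + (if 3 ≤ h then Fh (h-3) else 0)) := by
  ext n
  cases n with
  | zero =>
    by_cases h0 : h = 0 <;> simp [Fh, walkCount, h0]
  | succ n =>
    have e : (coeff (n+1)) (if h = 0 then (1 : PowerSeries ℚ) else 0) = 0 := by
      split_ifs <;> simp [coeff_one]
    rw [map_add, e, coeff_succ_X_mul]
    by_cases h3 : 3 ≤ h
    · simp [Fh, walkCount, h3]
    · have : walkCount n ((h:ℤ) - 3) = 0 := walkCount_neg _ _ (by omega)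
      simp [Fh, walkCount, h3, this]

theorem kernel_eq :
    (PowerSeries.X ^ 2 - PowerSeries.C (PowerSeries.X : PowerSeries ℚ) *
      (1 + PowerSeries.X + PowerSeries.X ^ 5)) * PowerSeries.mk Fh
    = PowerSeries.X ^ 2 - PowerSeries.C (PowerSeries.X * (Fh 0 + Fh 1)) * PowerSeries.X
      + PowerSeries.C (- (PowerSeries.X * Fh 0)) := by
  have e : (PowerSeries.X ^ 2 - PowerSeries.C (PowerSeries.X : PowerSeries ℚ) *
      (1 + PowerSeries.X + PowerSeries.X ^ 5)) * PowerSeries.mk Fh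
      = PowerSeries.X ^ 2 * PowerSeries.mk Fh
       - PowerSeries.C (PowerSeries.X : PowerSeries ℚ) * (PowerSeries.mk Fh
        + PowerSeries.X ^ 1 * PowerSeries.mk Fh + PowerSeries.X ^ 5 * PowerSeries.mk Fh) := by ring
  rw [e]
  ext1 k
  simp only [map_sub, map_add, PowerSeries.coeff_C_mul, PowerSeries.coeff_X_pow_mul',
    PowerSeries.coeff_mk, PowerSeries.coeff_X_pow, PowerSeries.coeff_X, PowerSeries.coeff_C]
  match k with
  | 0 => simp
  | 1 => simp; ring
  | 2 =>
    have := Fh_rec 0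
    simp at this ⊢
    linear_combination this
  | (k+3) =>
    have := Fh_rec (k+1)
    by_cases hk : 2 ≤ k
    · have h2 : 3 ≤ k + 1 := by omega
      have h3 : 5 ≤ k + 3 := by omega
      have h4 : k + 1 - 3 = k + 3 - 5 := by omega
      simp [h2, h4] at this ⊢
      rw [if_pos hk]
      linear_combination this
    · have h2 : ¬ 3 ≤ k + 1 := by omega
      have h3 : ¬ 5 ≤ k + 3 := by omega
      simp [hk] at this ⊢
      linear_combination this

theorem Fh_zero_const : PowerSeries.constantCoeff (Fh 0) = 1 := by
  simp [Fh, ← PowerSeries.coeff_zero_eq_constantCoeff_apply, walkCount]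

/-- Uniqueness in Weierstrass division by a distinguished quadratic. -/
theorem weier (s p : PowerSeries ℚ) (hs : PowerSeries.X ∣ s) (hp : PowerSeries.X ∣ p)
    (g : ℕ → PowerSeries ℚ) (hg : ∀ k, g k = s * g (k+1) - p * g (k+2)) : ∀ k, g k = 0 := by
  have : ∀ m k, PowerSeries.X ^ m ∣ g k := by
    intro m
    induction m with
    | zero => intro k; simp
    | succ m ih =>
      intro k
      rw [hg k, pow_succ']
      exact dvd_sub (mul_dvd_mul hs (ih _)) (mul_dvd_mul hp (ih _))
  intro k
  ext n
  have := (PowerSeries.X_pow_dvd_iff).1 (this (n+1) k) n (by omega)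
  simpa using this

theorem curve_eqs (s p : PowerSeries ℚ) (hs : s = PowerSeries.X * (Fh 0 + Fh 1))
    (hp : p = - (PowerSeries.X * Fh 0)) :
    p ^ 2 * s ^ 2 - s - p - p ^ 3 = 0 ∧
    PowerSeries.X * (s * (1 + p ^ 3 - p ^ 5) + p) = p ^ 4 := by
  have hk := kernel_eq
  rw [← hs, ← hp] at hk
  have hu : IsUnit (PowerSeries.mk Fh) := by
    rw [PowerSeries.isUnit_iff_constantCoeff, ← PowerSeries.coeff_zero_eq_constantCoeff_apply,
      PowerSeries.coeff_mk, PowerSeries.isUnit_iff_constantCoeff, Fh_zero_const]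
    exact isUnit_one
  obtain ⟨U, hU⟩ := hu
  set H : PowerSeries (PowerSeries ℚ) := ↑U⁻¹ with hH
  have hFH : PowerSeries.mk Fh * H = 1 := by rw [← hU, hH]; simp
  set x : PowerSeries ℚ := PowerSeries.X with hx
  let u : PowerSeries (PowerSeries ℚ) := PowerSeries.X
  let c : PowerSeries ℚ →+* PowerSeries (PowerSeries ℚ) := PowerSeries.C
  have hK : (u ^ 2 - c x * (1 + u + u ^ 5)) = (u ^ 2 - c s * u + c p) * H := by
    have := congrArg (· * H) hk
    simp only [mul_assoc, hFH, mul_one] at this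
    exact this
  let q0 := 1 - x * (s ^ 3 - 2 * p * s)
  let q : PowerSeries (PowerSeries ℚ) :=
    - c x * u ^ 3 - c (x * s) * u ^ 2 - c (x * (s ^ 2 - p)) * u + c q0
  let r1 := - x + x * (p * (s ^ 2 - p)) + s * q0
  let r0 := - x - p * q0
  have hdiv : (u ^ 2 - c x * (1 + u + u ^ 5)) = (u ^ 2 - c s * u + c p) * q + c r1 * u + c r0 := by
    simp only [q, r1, r0, q0, map_sub, map_add, map_mul, map_pow, map_one, map_neg, map_ofNat]
    ring
  have hD : u ^ 2 * (H - q) - c s * (u ^ 1 * (H - q)) + c p * (H - q) = c r1 * u + c r0 := by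
    linear_combination hdiv - hK
  have hg := weier s p ⟨_, hs⟩ ⟨- Fh 0, by rw [hp]; ring⟩ (fun k => PowerSeries.coeff k (H - q)) (by
    intro k
    have := congrArg (PowerSeries.coeff (k+2)) hD
    simp only [u, c, map_sub (PowerSeries.coeff (k+2)), map_add (PowerSeries.coeff (k+2)),
      PowerSeries.coeff_C_mul, PowerSeries.coeff_X_pow_mul',
      PowerSeries.coeff_X, PowerSeries.coeff_C] at this
    simp at this
    simp only [map_sub]
    linear_combination this)
  have hz : H - q = 0 := by
    ext1 k; simpa using hg k
  rw [hz] at hD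
  have h0 := congrArg (PowerSeries.coeff 0) hD
  have h1 := congrArg (PowerSeries.coeff 1) hD
  simp [u, c, PowerSeries.coeff_X, PowerSeries.coeff_C] at h0 h1
  have h0' : r0 = 0 := h0.symm
  have h1' : r1 = 0 := h1.symm
  simp only [r0, r1] at h0' h1'
  have hx0 : x ≠ 0 := PowerSeries.X_ne_zero
  have A : p ^ 2 * s ^ 2 - s - p - p ^ 3 = 0 := by
    apply mul_left_cancel₀ hx0
    linear_combination p * h1' + s * h0'
  refine ⟨A, ?_⟩
  simp only [q0] at h0'
  linear_combination p ^ 3 * h0' + (- x * (p ^ 2 * s + 1)) * A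

section Curve
open Polynomial

/-- The base ring `ℚ[N]`. -/
abbrev LL := Polynomial ℚ

noncomputable def pQ : LL[X] := 1 + 4 * X ^ 3 + 4 * X ^ 5
noncomputable def pQ2 : LL[X] := 6 * X ^ 2 + 10 * X ^ 4
noncomputable def pw0 : LL[X] := 1 + 3 * X ^ 3 - X ^ 5
noncomputable def pw1 : LL[X] := - (1 + X ^ 3 - X ^ 5)
noncomputable def pv0 : LL[X] :=
  (-3 * X ^ 3 + 5 * X ^ 5) * pQ + pw1 * (6 * X ^ 3 + 10 * X ^ 5) - 6 * pQ * pw1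
noncomputable def pv1 : LL[X] := -6 - 9 * X ^ 3 + X ^ 5

/-- the components of `w ^ i * R` -/
noncomputable def wR : ℕ → LL[X] × LL[X]
  | 0 => (0, 1)
  | (i+1) => (pw0 * (wR i).1 + pw1 * pQ * (wR i).2, pw0 * (wR i).2 + pw1 * (wR i).1)

noncomputable def rhs1 (A B : LL[X]) : LL[X] :=
  C X * (pv0 * A + pv1 * B * pQ) +
    pw0 * (X * (derivative B * pQ + B * pQ2) - 113 * pQ * B) +
    pw1 * pQ * (X * derivative A - 113 * A)

noncomputable def rhs2 (A B : LL[X]) : LL[X] :=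
  C X * (pv0 * B + pv1 * A) + pw0 * (X * derivative A - 113 * A) +
    pw1 * (X * (derivative B * pQ + B * pQ2) - 113 * pQ * B)

noncomputable def lhs1 (c : Fin 21 → LL) : LL[X] :=
  ∑ i : Fin 21, C (c i) * (X ^ (120 - 6 * (i : ℕ)) * (wR i).1)

noncomputable def lhs2 (c : Fin 21 → LL) : LL[X] :=
  ∑ i : Fin 21, C (c i) * (X ^ (120 - 6 * (i : ℕ)) * (wR i).2)

/-- evaluation of `ℚ[N][p]` at a number and a power series -/
noncomputable def Psi (t : ℚ) (p : PowerSeries ℚ) : LL[X] →+* PowerSeries ℚ :=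
  eval₂RingHom ((PowerSeries.C).comp (evalRingHom t)) p

theorem Psi_X (t : ℚ) (p : PowerSeries ℚ) : Psi t p X = p := by simp [Psi]
theorem Psi_C (t : ℚ) (p : PowerSeries ℚ) (c : LL) :
    Psi t p (C c) = PowerSeries.C (c.eval t) := by simp [Psi]

theorem Psi_deriv (t : ℚ) (p : PowerSeries ℚ) (A : LL[X]) :
    PowerSeries.derivative ℚ (Psi t p A)
      = Psi t p (derivative A) * PowerSeries.derivative ℚ p := by
  induction A using Polynomial.induction_on' with
  | add A B hA hB => rw [map_add, map_add, hA, hB, derivative_add, map_add]; ring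
  | monomial k c =>
    rw [← C_mul_X_pow_eq_monomial, derivative_C_mul, map_mul (Psi t p), map_mul (Psi t p), map_pow (Psi t p), Psi_C, Psi_X,
      Derivation.leibniz, Derivation.leibniz_pow, derivative_X_pow]
    simp [Psi_C, Psi_X]
    ring

theorem Psi_wR (t : ℚ) (p R : PowerSeries ℚ) (hR : R ^ 2 = 1 + 4 * p ^ 3 + 4 * p ^ 5) (i : ℕ) :
    Psi t p (wR i).1 + Psi t p (wR i).2 * R
      = ((1 + 3 * p ^ 3 - p ^ 5) - (1 + p ^ 3 - p ^ 5) * R) ^ i * R := by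
  induction i with
  | zero => simp [wR]
  | succ i ih =>
    rw [pow_succ', mul_assoc, ← ih]
    simp only [wR, pw0, pw1, pQ, map_add, map_sub, map_mul, map_neg, map_pow, map_one, map_ofNat,
      Psi_X]
    linear_combination ((1 + p ^ 3 - p ^ 5) * Psi t p (wR i).2) * hR

theorem pow_split (y : PowerSeries ℚ) (k m n : ℕ) (h : n = k + m) : y ^ n = y ^ k * y ^ m := by
  rw [h, pow_add]

theorem clear_aux (m : ℕ) (x p g E : PowerSeries ℚ) (hx : x = PowerSeries.X)
    (hp : p = - (x * E)) (hE : PowerSeries.constantCoeff E = 1) :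
    ∃ f, x ^ m * g = p ^ m * f := by
  refine ⟨(-1) ^ m * E⁻¹ ^ m * g, ?_⟩
  have hEi : E * E⁻¹ = 1 := PowerSeries.mul_inv_cancel E (by rw [hE]; exact one_ne_zero)
  have e : p * (-1) * E⁻¹ = x := by rw [hp]; linear_combination x * hEi
  rw [← mul_assoc, ← mul_assoc, ← mul_pow, ← mul_pow, e]

theorem deriv_aux (m : ℕ) (x p g f : PowerSeries ℚ) (hx : x = PowerSeries.X)
    (hf : x ^ (m + 1) * g = p ^ (m + 1) * f) :
    x ^ (m + 1) * (x * (p * PowerSeries.derivative ℚ g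
      - ((m + 1 : ℕ) : PowerSeries ℚ) * PowerSeries.derivative ℚ p * g))
      = p ^ (m + 2) * (x * PowerSeries.derivative ℚ f - ((m + 1 : ℕ) : PowerSeries ℚ) * f) := by
  have hDx : PowerSeries.derivative ℚ x = 1 := by simp [hx]
  have := congrArg (PowerSeries.derivative ℚ) hf
  simp only [Derivation.leibniz, Derivation.leibniz_pow, smul_eq_mul,
    nsmul_eq_mul, hDx, Nat.add_sub_cancel] at this
  linear_combination x * p * this - ((m + 1 : ℕ) : PowerSeries ℚ) * p * hf
    - ((m + 1 : ℕ) : PowerSeries ℚ) * x * PowerSeries.derivative ℚ p * hf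

theorem residue (c : Fin 21 → LL) (A B : LL[X]) (h1 : lhs1 c = rhs1 A B)
    (h2 : lhs2 c = rhs2 A B) (p R E : PowerSeries ℚ) (hp : p = - (PowerSeries.X * E))
    (hE : PowerSeries.constantCoeff E = 1)
    (hR : R ^ 2 = 1 + 4 * p ^ 3 + 4 * p ^ 5)
    (hw : PowerSeries.X * ((1 + 3 * p ^ 3 - p ^ 5) - (1 + p ^ 3 - p ^ 5) * R) = 2 * p ^ 6) (n : ℕ) :
    ∑ i : Fin 21, (c i).eval ((n : ℚ) + 2) * 2 ^ (i : ℕ) *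
      (PowerSeries.coeff (n + (i : ℕ)) (PowerSeries.derivative ℚ p)) = 0 := by
  set t : ℚ := (n : ℚ) + 2 with ht
  clear_value t
  set x : PowerSeries ℚ := PowerSeries.X with hx
  let D := PowerSeries.derivative ℚ
  have hx0 : x ≠ 0 := PowerSeries.X_ne_zero
  have hDx : D x = 1 := by simp [D, hx]
  have hE0 : E ≠ 0 := by rintro rfl; simp at hE
  have hp0 : p ≠ 0 := by rw [hp]; exact neg_ne_zero.2 (mul_ne_zero hx0 hE0)
  have hR0 : R ≠ 0 := by
    rintro rfl
    have := congrArg PowerSeries.constantCoeff hR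
    rw [hp] at this
    simp [hx] at this
  obtain ⟨w, hwd⟩ : ∃ w, w = (1 + 3 * p ^ 3 - p ^ 5) - (1 + p ^ 3 - p ^ 5) * R := ⟨_, rfl⟩
  have hPw := Psi_wR t p R hR
  rw [← hwd] at hw hPw
  set aa := Psi t p A
  set bb := Psi t p B
  set dA := Psi t p (derivative A) with hdA
  set dB := Psi t p (derivative B) with hdB
  have DA : D aa = dA * D p := Psi_deriv t p A
  have DB : D bb = dB * D p := Psi_deriv t p B
  obtain ⟨g, hg⟩ : ∃ g, g = aa + bb * R := ⟨_, rfl⟩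
  have DR : R * D R = (6 * p ^ 2 + 10 * p ^ 4) * D p := by
    have := congrArg D hR
    have e4 : D 4 = 0 := D.map_natCast 4
    simp only [map_add, Derivation.leibniz, Derivation.leibniz_pow, smul_eq_mul,
      Derivation.map_one_eq_zero, nsmul_eq_mul, e4] at this
    have h2 : (2 : PowerSeries ℚ) ≠ 0 := by
      intro h
      have := congrArg PowerSeries.constantCoeff h
      rw [map_ofNat] at this
      simp at this
    apply mul_left_cancel₀ h2
    norm_num at this
    linear_combination this
  have Dg : D g = dA * D p + dB * D p * R + bb * D R := by
    rw [hg, map_add, Derivation.leibniz, DA, DB, smul_eq_mul, smul_eq_mul]; ring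
  have Dw : D w = (9 * p ^ 2 - 5 * p ^ 4) * D p - (3 * p ^ 2 - 5 * p ^ 4) * D p * R
      - (1 + p ^ 3 - p ^ 5) * D R := by
    have e3 : D 3 = 0 := D.map_natCast 3
    rw [hwd]
    simp only [map_add, map_sub, Derivation.leibniz, Derivation.leibniz_pow, smul_eq_mul,
      Derivation.map_one_eq_zero, nsmul_eq_mul, e3]
    norm_num
    ring
  have xDw : x * (p * D w - 6 * D p * w) = - p * w := by
    have := congrArg D hw
    have e2 : D 2 = 0 := D.map_natCast 2
    simp only [Derivation.leibniz, Derivation.leibniz_pow, smul_eq_mul,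
      nsmul_eq_mul, e2, hDx] at this
    norm_num at this
    linear_combination p * this - 6 * D p * hw
  -- the evaluated identity
  let S := ∑ i : Fin 21, PowerSeries.C ((c i).eval t) * (p ^ (120 - 6 * (i : ℕ)) * w ^ (i : ℕ))
  have hS : S * R = Psi t p (lhs1 c) + Psi t p (lhs2 c) * R := by
    simp only [S, lhs1, lhs2, map_sum, Finset.sum_mul, ← Finset.sum_add_distrib]
    refine Finset.sum_congr rfl fun i _ => ?_
    simp only [map_mul, map_pow, Psi_C, Psi_X]
    linear_combination (- PowerSeries.C ((c i).eval t) * p ^ (120 - 6 * (i : ℕ))) * hPw i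
  rw [h1, h2] at hS
  simp only [rhs1, rhs2, pv0, pv1, pw0, pw1, pQ, pQ2, map_add, map_sub, map_mul, map_neg, map_pow,
    map_one, map_ofNat, Psi_C, Psi_X, eval_X] at hS
  have hmain : x * D p * S = w * (- PowerSeries.C t * p * g + x * (p * D g - 113 * D p * g)) := by
    apply mul_right_cancel₀ hR0
    have k1 : D p * (Psi t p pv0 + Psi t p pv1 * R) = R * (p * D w - 6 * D p * w) := by
      simp only [pv0, pv1, pw0, pw1, pQ, map_add, map_sub, map_mul, map_neg, map_pow,
        map_one, map_ofNat, Psi_X]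
      rw [Dw, hwd]
      linear_combination ((1 + p ^ 3 - p ^ 5) * p) * DR +
        (- D p * (p * (-3 * p ^ 2 + 5 * p ^ 4) + 6 * (1 + p ^ 3 - p ^ 5))) * hR
    have k2 : D p * (dB * (1 + 4 * p ^ 3 + 4 * p ^ 5) + bb * (6 * p ^ 2 + 10 * p ^ 4) + dA * R)
        = R * D g := by
      rw [Dg]
      linear_combination (-bb) * DR - (D p * dB) * hR
    have k3 : S * R = PowerSeries.C t * (Psi t p pv0 + Psi t p pv1 * R) * g
        + w * (p * (dB * (1 + 4 * p ^ 3 + 4 * p ^ 5) + bb * (6 * p ^ 2 + 10 * p ^ 4) + dA * R)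
          - 113 * R * g) := by
      rw [hS, hg, hwd]
      simp only [pv0, pv1, pw0, pw1, pQ, map_add, map_sub, map_mul, map_neg, map_pow,
        map_one, map_ofNat, Psi_X]
      linear_combination (- (PowerSeries.C t * (-6 - 9 * p ^ 3 + p ^ 5) * bb
        - 113 * (1 + 3 * p ^ 3 - p ^ 5) * bb - (1 + p ^ 3 - p ^ 5) * (p * dA - 113 * aa)
        + 113 * (1 + p ^ 3 - p ^ 5) * bb * R)) * hR
    linear_combination x * D p * k3 + x * PowerSeries.C t * g * k1 + x * w * p * k2
      + R * PowerSeries.C t * g * xDw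
  -- clear denominators
  have hSx : S * x ^ 20 = p ^ 120 * ∑ i : Fin 21,
      PowerSeries.C ((c i).eval t * 2 ^ (i : ℕ)) * x ^ (20 - (i : ℕ)) := by
    simp only [S, Finset.sum_mul, Finset.mul_sum]
    refine Finset.sum_congr rfl fun i _ => ?_
    have hi : (i : ℕ) ≤ 20 := by omega
    have e1 : x ^ 20 = x ^ (i : ℕ) * x ^ (20 - (i : ℕ)) := pow_split _ _ _ _ (by omega)
    have e2 : p ^ 120 = p ^ (120 - 6 * (i : ℕ)) * (p ^ 6) ^ (i : ℕ) := by
      rw [← pow_mul]; exact pow_split _ _ _ _ (by omega)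
    have e3 : x ^ (i : ℕ) * w ^ (i : ℕ) = 2 ^ (i : ℕ) * (p ^ 6) ^ (i : ℕ) := by
      rw [← mul_pow, hw, mul_pow]
    rw [e1, e2, map_mul, map_pow, map_ofNat]
    linear_combination (PowerSeries.C ((c i).eval t) * p ^ (120 - 6 * (i : ℕ))
      * x ^ (20 - (i : ℕ))) * e3
  obtain ⟨f, hf⟩ : ∃ f, x ^ 113 * g = p ^ 113 * f := clear_aux 113 x p g E hx hp hE
  have Df : x ^ 113 * (x * (p * D g - 113 * D p * g)) = p ^ 114 * (x * D f - 113 * f) :=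
    deriv_aux 112 x p g f hx hf
  let T := ∑ i : Fin 21, PowerSeries.C ((c i).eval t * 2 ^ (i : ℕ)) * x ^ (20 - (i : ℕ))
  have hT : x ^ 95 * T * D p = 2 * (x * D f - (113 + PowerSeries.C t) * f) := by
    have hne : x ^ 39 * p ^ 120 ≠ 0 := mul_ne_zero (pow_ne_zero _ hx0) (pow_ne_zero _ hp0)
    apply mul_left_cancel₀ hne
    have hSx' : S * x ^ 20 = p ^ 120 * T := hSx
    linear_combination (- x ^ 134 * D p) * hSx' + x ^ 153 * hmain
      + x ^ 152 * (- PowerSeries.C t * p * g + x * (p * D g - 113 * D p * g)) * hw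
      - 2 * x ^ 39 * p ^ 7 * PowerSeries.C t * hf + 2 * x ^ 39 * p ^ 6 * Df
  have hT2 : ∑ i : Fin 21, PowerSeries.C ((c i).eval t * 2 ^ (i : ℕ)) *
      (x ^ (115 - (i : ℕ)) * D p) = 2 * (x * D f - (113 + PowerSeries.C t) * f) := by
    rw [← hT]
    simp only [T, Finset.sum_mul, Finset.mul_sum]
    refine Finset.sum_congr rfl fun i _ => ?_
    have e : x ^ (115 - (i : ℕ)) = x ^ 95 * x ^ (20 - (i : ℕ)) := pow_split _ _ _ _ (by omega)
    rw [e]; ring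
  have hc := congrArg (PowerSeries.coeff (n + 115)) hT2
  have z : (2 : PowerSeries ℚ) * (x * D f - (113 + PowerSeries.C t) * f)
      = PowerSeries.C 2 * (x * D f - PowerSeries.C (113 + t) * f) := by
    rw [map_add, map_ofNat, map_ofNat]
  rw [z, PowerSeries.coeff_C_mul, map_sub, PowerSeries.coeff_C_mul,
    show n + 115 = (n + 114) + 1 by omega, hx, PowerSeries.coeff_succ_X_mul] at hc
  simp only [D, PowerSeries.coeff_derivative] at hc
  have z2 : (PowerSeries.coeff (n + 114 + 1)) f * (((n + 114 : ℕ) : ℚ) + 1)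
      - (113 + t) * (PowerSeries.coeff (n + 114 + 1)) f = 0 := by
    rw [ht]; push_cast; ring
  rw [z2, mul_zero, map_sum] at hc
  rw [← hc]
  refine Finset.sum_congr rfl fun i _ => ?_
  rw [PowerSeries.coeff_C_mul, PowerSeries.coeff_X_pow_mul', if_pos (by omega)]
  have e : n + 114 + 1 - (115 - (i : ℕ)) = n + (i : ℕ) := by omega
  rw [e]

end Curve

section Count
open Polynomial

theorem pQ_deg : pQ.natDegree ≤ 5 := by unfold pQ; compute_degree
theorem pQ2_deg : pQ2.natDegree ≤ 4 := by unfold pQ2; compute_degree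
theorem pw0_deg : pw0.natDegree ≤ 5 := by unfold pw0; compute_degree
theorem pw1_deg : pw1.natDegree ≤ 5 := by unfold pw1; compute_degree
theorem pv1_deg : pv1.natDegree ≤ 5 := by unfold pv1; compute_degree
theorem pv0_deg : pv0.natDegree ≤ 10 := by unfold pv0 pQ pw1; compute_degree

theorem wR_deg (i : ℕ) : 2 * (wR i).1.natDegree ≤ 15 * i + 5 ∧
    2 * (wR i).2.natDegree + 5 ≤ 15 * i + 5 := by
  induction i with
  | zero => simp [wR]
  | succ i ih =>
    obtain ⟨h1, h2⟩ := ih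
    have q := pQ_deg
    have w0 := pw0_deg
    have w1 := pw1_deg
    simp only [wR]
    have a1 := natDegree_add_le (pw0 * (wR i).1) (pw1 * pQ * (wR i).2)
    have a2 := natDegree_add_le (pw0 * (wR i).2) (pw1 * (wR i).1)
    have b1 := natDegree_mul_le (p := pw0) (q := (wR i).1)
    have b2 := natDegree_mul_le (p := pw0) (q := (wR i).2)
    have b3 := natDegree_mul_le (p := pw1) (q := (wR i).1)
    have b4 := natDegree_mul_le (p := pw1 * pQ) (q := (wR i).2)
    have b5 := natDegree_mul_le (p := pw1) (q := pQ)
    constructor <;> omega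

theorem lhs1_deg (c : Fin 21 → LL) : (lhs1 c).natDegree ≤ 152 := by
  unfold lhs1
  refine natDegree_sum_le_of_forall_le _ _ fun i _ => ?_
  have h := wR_deg i
  have b1 := natDegree_C_mul_le (c i) (X ^ (120 - 6 * (i : ℕ)) * (wR i).1)
  have b2 := natDegree_mul_le (p := (X : LL[X]) ^ (120 - 6 * (i : ℕ))) (q := (wR i).1)
  rw [natDegree_X_pow] at b2
  omega

theorem lhs2_deg (c : Fin 21 → LL) : (lhs2 c).natDegree ≤ 150 := by
  unfold lhs2
  refine natDegree_sum_le_of_forall_le _ _ fun i _ => ?_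
  have h := wR_deg i
  have b1 := natDegree_C_mul_le (c i) (X ^ (120 - 6 * (i : ℕ)) * (wR i).2)
  have b2 := natDegree_mul_le (p := (X : LL[X]) ^ (120 - 6 * (i : ℕ))) (q := (wR i).2)
  rw [natDegree_X_pow] at b2
  omega

theorem nd_add {P Q : LL[X]} {d : ℕ} (h1 : P.natDegree ≤ d) (h2 : Q.natDegree ≤ d) :
    (P + Q).natDegree ≤ d := natDegree_add_le_of_degree_le h1 h2
theorem nd_sub {P Q : LL[X]} {d : ℕ} (h1 : P.natDegree ≤ d) (h2 : Q.natDegree ≤ d) :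
    (P - Q).natDegree ≤ d := natDegree_sub_le_of_le (m := d) h1 h2 |>.trans (by simp)
theorem nd_mul {P Q : LL[X]} (m n : ℕ) {d : ℕ} (h1 : P.natDegree ≤ m) (h2 : Q.natDegree ≤ n)
    (h : m + n ≤ d) : (P * Q).natDegree ≤ d :=
  (natDegree_mul_le_of_le h1 h2).trans h

theorem eul_deg {A : LL[X]} {d : ℕ} (h : A.natDegree ≤ d) :
    (X * derivative A - 113 * A).natDegree ≤ d := by
  rw [natDegree_le_iff_coeff_eq_zero] at h ⊢
  intro k hk
  cases k with
  | zero => omega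
  | succ k =>
    rw [coeff_sub, coeff_X_mul, coeff_derivative, h _ hk, coeff_ofNat_mul, h _ hk]; simp

theorem eul_coeff (A : LL[X]) (k : ℕ) :
    (X * derivative A - 113 * A).coeff k = A.coeff k * (C ((k : ℚ) - 113)) := by
  have h113 : (C (113 : ℚ) : LL) = 113 := map_ofNat _ _
  cases k with
  | zero =>
    rw [coeff_sub, coeff_ofNat_mul, C_sub, h113]
    simp
    ring
  | succ k =>
    rw [coeff_sub, coeff_X_mul, coeff_derivative, coeff_ofNat_mul, C_sub, h113]
    simp
    ring

theorem eulB (B : LL[X]) : X * (derivative B * pQ + B * pQ2) - 113 * pQ * B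
    = (X * derivative B - 113 * B) * pQ + B * (X * pQ2) := by ring

theorem XQ2_deg : (X * pQ2).natDegree ≤ 5 := by unfold pQ2; compute_degree

theorem eulB_deg {B : LL[X]} {d : ℕ} (h : B.natDegree ≤ d) :
    (X * (derivative B * pQ + B * pQ2) - 113 * pQ * B).natDegree ≤ d + 5 := by
  rw [eulB]
  exact nd_add (nd_mul _ _ (eul_deg h) pQ_deg le_rfl) (nd_mul _ _ h XQ2_deg le_rfl)

theorem CX_deg : (C X : LL[X]).natDegree ≤ 0 := by simp

theorem rhs1_deg (A B : LL[X]) (a b d : ℕ) (hA : A.natDegree ≤ a) (hB : B.natDegree ≤ b)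
    (h1 : a + 10 ≤ d) (h2 : b + 10 ≤ d) : (rhs1 A B).natDegree ≤ d := by
  unfold rhs1
  refine nd_add (nd_add (nd_mul 0 d CX_deg (nd_add (nd_mul 10 a pv0_deg hA (by omega)) ?_)
    (by omega)) ?_) ?_
  · exact nd_mul (b+5) 5 (nd_mul 5 b pv1_deg hB (by omega)) pQ_deg (by omega)
  · exact nd_mul 5 (b+5) pw0_deg (eulB_deg hB) (by omega)
  · exact nd_mul 10 a (nd_mul 5 5 pw1_deg pQ_deg (by omega)) (eul_deg hA) (by omega)

theorem rhs2_deg (A B : LL[X]) (a b d : ℕ) (hA : A.natDegree ≤ a) (hB : B.natDegree ≤ b)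
    (h1 : a + 5 ≤ d) (h2 : b + 10 ≤ d) : (rhs2 A B).natDegree ≤ d := by
  unfold rhs2
  refine nd_add (nd_add (nd_mul 0 d CX_deg (nd_add (nd_mul 10 b pv0_deg hB (by omega)) ?_)
    (by omega)) ?_) ?_
  · exact nd_mul 5 a pv1_deg hA (by omega)
  · exact nd_mul 5 a pw0_deg (eul_deg hA) (by omega)
  · exact nd_mul 5 (b+5) pw1_deg (eulB_deg hB) (by omega)

theorem pQ_top : pQ.coeff 5 = 4 := by
  unfold pQ; simp [coeff_ofNat_mul, coeff_X_pow, coeff_one]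
theorem XQ2_top : (X * pQ2).coeff 5 = 10 := by
  unfold pQ2; simp [coeff_X_mul, coeff_ofNat_mul, coeff_X_pow]
theorem pw1_top : pw1.coeff 5 = 1 := by
  unfold pw1; simp [coeff_X_pow, coeff_one]
theorem pv0_top : pv0.coeff 10 = 6 := by
  have d1 : (-3 * X ^ 3 + 5 * X ^ 5 : LL[X]).natDegree ≤ 5 := by compute_degree
  have d2 : (6 * X ^ 3 + 10 * X ^ 5 : LL[X]).natDegree ≤ 5 := by compute_degree
  have d3 : (6 * pQ).natDegree ≤ 5 := by unfold pQ; compute_degree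
  have t1 : (-3 * X ^ 3 + 5 * X ^ 5 : LL[X]).coeff 5 = 5 := by
    rw [show (-3 * X ^ 3 + 5 * X ^ 5 : LL[X]) = 5 * X ^ 5 - 3 * X ^ 3 by ring]
    simp [coeff_ofNat_mul, coeff_X_pow]
  have t2 : (6 * X ^ 3 + 10 * X ^ 5 : LL[X]).coeff 5 = 10 := by
    simp [coeff_ofNat_mul, coeff_X_pow]
  unfold pv0
  rw [coeff_sub, coeff_add, show 10 = 5 + 5 from rfl,
    coeff_mul_add_eq_of_natDegree_le d1 pQ_deg, coeff_mul_add_eq_of_natDegree_le pw1_deg d2,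
    coeff_mul_add_eq_of_natDegree_le d3 pw1_deg, t1, t2, coeff_ofNat_mul, pQ_top, pw1_top]
  norm_num

theorem lin_ne (α : LL) (hα : α ≠ 0) (r : ℚ) : 6 * (X * α) + α * C r ≠ 0 := by
  have : 6 * (X * α) + α * C r = α * (6 * X + C r) := by ring
  rw [this]
  refine mul_ne_zero hα fun h => ?_
  have := congrArg (fun P : LL => P.coeff 1) h
  simp [coeff_ofNat_mul, coeff_C] at this

theorem rhs_inj (A B : LL[X]) (h1 : rhs1 A B = 0) (h2 : rhs2 A B = 0) : A = 0 ∧ B = 0 := by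
  by_contra hne
  by_cases hc : A ≠ 0 ∧ (B = 0 ∨ B.natDegree + 3 ≤ A.natDegree)
  · -- `A` dominates
    obtain ⟨hA, hB⟩ := hc
    have hα : A.leadingCoeff ≠ 0 := leadingCoeff_ne_zero.2 hA
    set a := A.natDegree with ha
    have hzero : ∀ P : LL[X], P.natDegree ≤ 10 → ∀ Q : LL[X], (B = 0 → Q = 0) →
        Q.natDegree ≤ B.natDegree → (P * Q).coeff (10 + a) = 0 := by
      intro P hP Q hQ0 hQ
      rcases hB with hB | hB
      · rw [hQ0 hB]; simp
      · exact coeff_eq_zero_of_natDegree_lt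
          (lt_of_le_of_lt (nd_mul 10 B.natDegree hP hQ le_rfl) (by omega))
    have e : rhs1 A B = C X * (pv0 * A) + (pw1 * pQ) * (X * derivative A - 113 * A)
        + (C X * ((pv1 * pQ) * B) + (pw0 * pQ) * (X * derivative B - 113 * B)
          + (pw0 * (X * pQ2)) * B) := by
      unfold rhs1; rw [eulB]; ring
    have hcf := congrArg (fun P : LL[X] => P.coeff (10 + a)) h1
    simp only [e, coeff_add, coeff_C_mul, coeff_zero] at hcf
    rw [hzero _ (nd_mul 5 5 pv1_deg pQ_deg le_rfl) B id le_rfl,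
      hzero _ (nd_mul 5 5 pw0_deg pQ_deg le_rfl) _ (by rintro rfl; simp) (eul_deg le_rfl),
      hzero _ (nd_mul 5 5 pw0_deg XQ2_deg le_rfl) B id le_rfl,
      coeff_mul_add_eq_of_natDegree_le pv0_deg le_rfl,
      coeff_mul_add_eq_of_natDegree_le (nd_mul 5 5 pw1_deg pQ_deg le_rfl) (eul_deg le_rfl),
      coeff_mul_add_eq_of_natDegree_le pw1_deg pQ_deg, pw1_top, pQ_top, pv0_top, eul_coeff] at hcf
    refine lin_ne A.leadingCoeff hα (4 * ((a : ℚ) - 113)) ?_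
    rw [C_mul, map_ofNat]
    rw [← ha, coeff_natDegree] at hcf
    linear_combination hcf
  · -- `B` dominates
    have hB : B ≠ 0 := by
      rintro rfl
      apply hc
      refine ⟨?_, Or.inl rfl⟩
      rintro rfl
      exact hne ⟨rfl, rfl⟩
    have hA : A.natDegree ≤ B.natDegree + 2 := by
      by_contra hlt
      apply hc
      refine ⟨?_, Or.inr (by omega)⟩
      rintro rfl
      simp at hlt
    have hβ : B.leadingCoeff ≠ 0 := leadingCoeff_ne_zero.2 hB
    set b := B.natDegree with hb
    have hzero : ∀ P : LL[X], P.natDegree ≤ 5 → ∀ Q : LL[X], Q.natDegree ≤ A.natDegree →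
        (P * Q).coeff (10 + b) = 0 := by
      intro P hP Q hQ
      exact coeff_eq_zero_of_natDegree_lt
          (lt_of_le_of_lt (nd_mul 5 A.natDegree hP hQ le_rfl) (by omega))
    have e : rhs2 A B = C X * (pv0 * B) + (pw1 * pQ) * (X * derivative B - 113 * B)
        + (pw1 * (X * pQ2)) * B
        + (C X * (pv1 * A) + pw0 * (X * derivative A - 113 * A)) := by
      unfold rhs2; rw [eulB]; ring
    have hcf := congrArg (fun P : LL[X] => P.coeff (10 + b)) h2
    simp only [e, coeff_add, coeff_C_mul, coeff_zero] at hcf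
    rw [hzero _ pv1_deg A le_rfl, hzero _ pw0_deg _ (eul_deg le_rfl),
      coeff_mul_add_eq_of_natDegree_le pv0_deg le_rfl,
      coeff_mul_add_eq_of_natDegree_le (nd_mul 5 5 pw1_deg pQ_deg le_rfl) (eul_deg le_rfl),
      coeff_mul_add_eq_of_natDegree_le (nd_mul 5 5 pw1_deg XQ2_deg le_rfl) le_rfl,
      coeff_mul_add_eq_of_natDegree_le pw1_deg pQ_deg, coeff_mul_add_eq_of_natDegree_le pw1_deg XQ2_deg,
      pw1_top, pQ_top, pv0_top, XQ2_top, eul_coeff] at hcf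
    refine lin_ne B.leadingCoeff hβ (4 * ((b : ℚ) - 113) + 10) ?_
    rw [C_add, C_mul, map_ofNat, map_ofNat]
    rw [← hb, coeff_natDegree] at hcf
    linear_combination hcf

/-- polynomials with prescribed coefficients -/
noncomputable def toP (m : ℕ) : (Fin m → LL) →ₗ[LL] LL[X] :=
  (degreeLT LL m).subtype ∘ₗ (degreeLTEquiv LL m).symm.toLinearMap

theorem toP_inj (m : ℕ) : Function.Injective (toP m) := by
  intro x y h
  simpa [toP] using h

theorem toP_deg (m : ℕ) (v : Fin (m+1) → LL) : (toP (m+1) v).natDegree ≤ m := by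
  have := ((degreeLTEquiv LL (m+1)).symm v).2
  rw [mem_degreeLT] at this
  have h2 : (toP (m+1) v).degree < ((m+1 : ℕ) : WithBot ℕ) := this
  by_cases h0 : toP (m+1) v = 0
  · rw [h0]; simp
  · rw [degree_eq_natDegree h0] at h2
    have : (toP (m+1) v).natDegree < m + 1 := by exact_mod_cast h2
    omega

noncomputable def diffMap1 : (Fin 21 → LL) × (LL[X] × LL[X]) →ₗ[LL] LL[X] where
  toFun v := lhs1 v.1 - rhs1 v.2.1 v.2.2
  map_add' u v := by
    simp only [lhs1, rhs1, Prod.fst_add, Prod.snd_add, Pi.add_apply, C_add, add_mul,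
      Finset.sum_add_distrib, derivative_add]
    ring
  map_smul' r v := by
    simp only [lhs1, rhs1, Prod.smul_fst, Prod.smul_snd, Pi.smul_apply, smul_eq_mul, C_mul,
      Polynomial.smul_eq_C_mul, derivative_C_mul, mul_assoc, ← Finset.mul_sum, RingHom.id_apply]
    ring

noncomputable def diffMap2 : (Fin 21 → LL) × (LL[X] × LL[X]) →ₗ[LL] LL[X] where
  toFun v := lhs2 v.1 - rhs2 v.2.1 v.2.2
  map_add' u v := by
    simp only [lhs2, rhs2, Prod.fst_add, Prod.snd_add, Pi.add_apply, C_add, add_mul,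
      Finset.sum_add_distrib, derivative_add]
    ring
  map_smul' r v := by
    simp only [lhs2, rhs2, Prod.smul_fst, Prod.smul_snd, Pi.smul_apply, smul_eq_mul, C_mul,
      Polynomial.smul_eq_C_mul, derivative_C_mul, mul_assoc, ← Finset.mul_sum, RingHom.id_apply]
    ring

/-- the first `m` coefficients -/
noncomputable def coefs (m : ℕ) : LL[X] →ₗ[LL] (Fin m → LL) :=
  LinearMap.pi fun i => lcoeff LL i

theorem coefs_eq_zero (m M : ℕ) (hM : M = m + 1) (P : LL[X]) (hP : P.natDegree ≤ m)
    (h : coefs M P = 0) :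
    P = 0 := by
  ext1 k
  rcases Nat.lt_or_ge m k with hk | hk
  · rw [coeff_eq_zero_of_natDegree_lt (by omega)]; simp
  · have := congrFun h ⟨k, by omega⟩
    simpa [coefs] using this

theorem diffMap1_apply (c : Fin 21 → LL) (A B : LL[X]) :
    diffMap1 (c, A, B) = lhs1 c - rhs1 A B := by
  simp only [diffMap1, LinearMap.coe_mk, AddHom.coe_mk]
theorem diffMap2_apply (c : Fin 21 → LL) (A B : LL[X]) :
    diffMap2 (c, A, B) = lhs2 c - rhs2 A B := by
  simp only [diffMap2, LinearMap.coe_mk, AddHom.coe_mk]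

theorem prod_zero {M N P : Type*} [AddCommGroup M] [AddCommGroup N] [AddCommGroup P] [Module LL M]
    [Module LL N] [Module LL P] (f : M →ₗ[LL] N) (g : M →ₗ[LL] P) (v : M)
    (h : LinearMap.prod f g v = 0) : f v = 0 ∧ g v = 0 :=
  ⟨congrArg Prod.fst h, congrArg Prod.snd h⟩

theorem exists_rel : ∃ (c : Fin 21 → LL) (A B : LL[X]), c ≠ 0 ∧ lhs1 c = rhs1 A B ∧
    lhs2 c = rhs2 A B := by
  let emb : (Fin 21 → LL) × ((Fin 143 → LL) × (Fin 141 → LL)) →ₗ[LL]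
      (Fin 21 → LL) × (LL[X] × LL[X]) :=
    LinearMap.prodMap LinearMap.id (LinearMap.prodMap (toP 143) (toP 141))
  let Φ : (Fin 21 → LL) × ((Fin 143 → LL) × (Fin 141 → LL)) →ₗ[LL]
      (Fin 153 → LL) × (Fin 151 → LL) :=
    LinearMap.prod ((coefs 153 ∘ₗ diffMap1) ∘ₗ emb) ((coefs 151 ∘ₗ diffMap2) ∘ₗ emb)
  have hni : ¬ Function.Injective Φ := by
    intro hi
    have := LinearMap.finrank_le_finrank_of_injective hi
    simp only [Module.finrank_prod, Module.finrank_fin_fun] at this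
    omega
  have : ∃ v, Φ v = 0 ∧ v ≠ 0 := by
    by_contra hcon
    push Not at hcon
    exact hni ((injective_iff_map_eq_zero Φ).2 hcon)
  obtain ⟨⟨c, va, vb⟩, hv, hv0⟩ := this
  obtain ⟨hv1, hv2⟩ := prod_zero _ _ _ hv
  rw [LinearMap.comp_apply, LinearMap.comp_apply] at hv1 hv2
  have hemb : emb (c, va, vb) = (c, toP 143 va, toP 141 vb) := by
    simp only [emb, LinearMap.prodMap_apply, LinearMap.id_apply]
  rw [hemb, diffMap1_apply] at hv1
  rw [hemb, diffMap2_apply] at hv2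
  have dA := toP_deg 142 va
  have dB := toP_deg 140 vb
  have e1 : lhs1 c - rhs1 (toP 143 va) (toP 141 vb) = 0 := by
    refine coefs_eq_zero 152 153 rfl _ (nd_sub (lhs1_deg c) ?_) hv1
    exact rhs1_deg _ _ 142 140 152 dA dB (by omega) (by omega)
  have e2 : lhs2 c - rhs2 (toP 143 va) (toP 141 vb) = 0 := by
    refine coefs_eq_zero 150 151 rfl _ (nd_sub (lhs2_deg c) ?_) hv2
    exact rhs2_deg _ _ 142 140 150 dA dB (by omega) (by omega)
  refine ⟨c, toP 143 va, toP 141 vb, ?_, sub_eq_zero.1 e1, sub_eq_zero.1 e2⟩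
  rintro rfl
  have z1 : lhs1 0 = 0 := by simp [lhs1]
  have z2 : lhs2 0 = 0 := by simp [lhs2]
  rw [z1, zero_sub, neg_eq_zero] at e1
  rw [z2, zero_sub, neg_eq_zero] at e2
  obtain ⟨ha, hb⟩ := rhs_inj _ _ e1 e2
  have ha' : va = 0 := toP_inj 143 (by rw [ha, map_zero])
  have hb' : vb = 0 := toP_inj 141 (by rw [hb, map_zero])
  exact hv0 (by rw [ha', hb']; rfl)

end Count

theorem stmt16 :
    ∃ q : Fin 21 → Polynomial ℚ, (∃ i, q i ≠ 0) ∧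
      ∀ n : ℕ, ∑ i : Fin 21, (q i).eval (n : ℚ) * (a (n + (i : ℕ)) : ℚ) = 0 := by
  obtain ⟨c, A, B, hc, h1, h2⟩ := exists_rel
  refine ⟨fun i => (c i).comp (Polynomial.X + Polynomial.C 2) * Polynomial.C (2 ^ (i : ℕ)) *
    (Polynomial.X + Polynomial.C ((i : ℚ) + 1)), ?_, ?_⟩
  · obtain ⟨i, hi⟩ := Function.ne_iff.1 hc
    refine ⟨i, mul_ne_zero (mul_ne_zero ?_ ?_) (Polynomial.X_add_C_ne_zero _)⟩
    · intro h
      apply hi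
      have := congrArg (fun P => P.comp (Polynomial.X - Polynomial.C 2)) h
      simpa [Polynomial.comp_assoc] using this
    · rw [Polynomial.C_ne_zero]
      positivity
  · intro n
    obtain ⟨s, hs⟩ : ∃ s, s = PowerSeries.X * (Fh 0 + Fh 1) := ⟨_, rfl⟩
    obtain ⟨p, hp⟩ : ∃ p, p = - (PowerSeries.X * Fh 0) := ⟨_, rfl⟩
    obtain ⟨hA, hB⟩ := curve_eqs s p hs hp
    have key := residue c A B h1 h2 p (1 - 2 * p ^ 2 * s) (Fh 0) hp Fh_zero_const
      (by linear_combination 4 * p ^ 2 * hA) (by linear_combination 2 * p ^ 2 * hB) n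
    rw [← neg_eq_zero, ← Finset.sum_neg_distrib] at key
    rw [← key]
    refine Finset.sum_congr rfl fun i _ => ?_
    rw [PowerSeries.coeff_derivative, hp, map_neg, PowerSeries.coeff_succ_X_mul, a_eq_walkCount]
    simp [Fh]
    ring
end
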